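/- For any (n,2^{nR_a},2^{nR_b}) code on the memoryless FS-MAC with noisy CSIT, the mutual information between the message pair and the received sequences is bounded by the sum of single-letter conditional mutual informations evaluated at the induced Shannon strategies: I(W; Y_{[n]}, S_{[n]}) ≤ Σ_{t=1}^n I(T_t^a, T_t^b; Y_t | S_{[t]}), where W=(W_a,W_b). -/

import Mathlib

open scoped BigOperators
open Finset

noncomputable section

/-- Shannon entropy (base 2) of a pmf on a finite type (convention `0 * log 0 = 0`). -/
def ent {α : Type} [Fintype α] (p : α → ℝ) : ℝ :=
  -∑ x, p x * Real.logb 2 (p x)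

/-- `p` is a probability mass function. -/
def isPMF {α : Type} [Fintype α] (p : α → ℝ) : Prop :=
  (∀ x, 0 ≤ p x) ∧ ∑ x, p x = 1

/-- Mutual information `I(A;B)` computed from a joint pmf on `α × β`. -/
def mutInfo {α β : Type} [Fintype α] [Fintype β] (p : α × β → ℝ) : ℝ :=
  ent (fun a => ∑ b, p (a, b)) + ent (fun b => ∑ a, p (a, b)) - ent p

/-- Conditional mutual information `I(A;B|C)` computed from a joint pmf on `α × β × γ`. -/
def condMutInfo {α β γ : Type} [Fintype α] [Fintype β] [Fintype γ]
    (p : α × β × γ → ℝ) : ℝ :=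
  ent (fun ac : α × γ => ∑ b, p (ac.1, b, ac.2))
    + ent (fun bc : β × γ => ∑ a, p (a, bc.1, bc.2))
    - ent p
    - ent (fun c : γ => ∑ a, ∑ b, p (a, b, c))

/-- A two-user memoryless finite-state MAC with i.i.d. state, noisy causal CSIT
(through the kernels `Qa`, `Qb`) and complete CSIR. -/
structure FSMAC (S Sa Sb Xa Xb Y : Type) [Fintype S] [Fintype Sa] [Fintype Sb]
    [Fintype Xa] [Fintype Xb] [Fintype Y] : Type where
  PS : S → ℝ
  Qa : S → Sa → ℝ
  Qb : S → Sb → ℝ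
  chan : Xa → Xb → S → Y → ℝ
  PS_pmf : isPMF PS
  Qa_pmf : ∀ s, isPMF (Qa s)
  Qb_pmf : ∀ s, isPMF (Qb s)
  chan_pmf : ∀ xa xb s, isPMF (chan xa xb s)

variable {S Sa Sb Xa Xb Y : Type} [Fintype S] [Fintype Sa] [Fintype Sb]
  [Fintype Xa] [Fintype Xb] [Fintype Y] [DecidableEq Sa] [DecidableEq Sb]

/-- `P_{Y|T^a,T^b,S}(y|t^a,t^b,s)`: channel kernel at the level of Shannon strategies. -/
def stratKernel (M : FSMAC S Sa Sb Xa Xb Y) (ta : Sa → Xa) (tb : Sb → Xb)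
    (s : S) (y : Y) : ℝ :=
  ∑ sa, ∑ sb, M.Qa s sa * M.Qb s sb * M.chan (ta sa) (tb sb) s y

/-- Joint single-letter law of `((T^a,T^b),Y,S)` induced by a memoryless stationary
team policy `(πa, πb)`. -/
def teamLaw (M : FSMAC S Sa Sb Xa Xb Y) (πa : (Sa → Xa) → ℝ) (πb : (Sb → Xb) → ℝ) :
    ((Sa → Xa) × (Sb → Xb)) × Y × S → ℝ :=
  fun x => M.PS x.2.2 * πa x.1.1 * πb x.1.2 * stratKernel M x.1.1 x.1.2 x.2.2 x.2.1

/-- `I(T^a;Y|T^b,S)` under the team policy law. -/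
def Ia (M : FSMAC S Sa Sb Xa Xb Y) (πa : (Sa → Xa) → ℝ) (πb : (Sb → Xb) → ℝ) : ℝ :=
  condMutInfo (fun x : (Sa → Xa) × Y × ((Sb → Xb) × S) =>
    teamLaw M πa πb ((x.1, x.2.2.1), x.2.1, x.2.2.2))

/-- `I(T^b;Y|T^a,S)` under the team policy law. -/
def Ib (M : FSMAC S Sa Sb Xa Xb Y) (πa : (Sa → Xa) → ℝ) (πb : (Sb → Xb) → ℝ) : ℝ :=
  condMutInfo (fun x : (Sb → Xb) × Y × ((Sa → Xa) × S) =>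
    teamLaw M πa πb ((x.2.2.1, x.1), x.2.1, x.2.2.2))

/-- `I(T^a,T^b;Y|S)` under the team policy law. -/
def Isum (M : FSMAC S Sa Sb Xa Xb Y) (πa : (Sa → Xa) → ℝ) (πb : (Sb → Xb) → ℝ) : ℝ :=
  condMutInfo (teamLaw M πa πb)

/-- The region `ℛ(π)` of a memoryless stationary team policy `π = (πa, πb)`. -/
def rateRegion (M : FSMAC S Sa Sb Xa Xb Y) (πa : (Sa → Xa) → ℝ)
    (πb : (Sb → Xb) → ℝ) : Set (ℝ × ℝ) :=
  {R : ℝ × ℝ | 0 ≤ R.1 ∧ 0 ≤ R.2 ∧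
    R.1 < Ia M πa πb ∧ R.2 < Ib M πa πb ∧ R.1 + R.2 < Isum M πa πb}

/-- A block code with causal encoders (encoder `a` sees `S^a_{[t]}`, encoder `b`
sees `S^b_{[t]}`) and a decoder with complete state information. -/
structure Code (M : FSMAC S Sa Sb Xa Xb Y) (n : ℕ) (Wa Wb : Type) : Type where
  encA : (t : Fin n) → (Fin (t.1 + 1) → Sa) → Wa → Xa
  encB : (t : Fin n) → (Fin (t.1 + 1) → Sb) → Wb → Xb
  dec : (Fin n → S) → (Fin n → Y) → Wa × Wb

/-- Joint pmf on messages, state sequences, noisy-observation sequences and outputs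
induced by a code (messages uniform and independent; memoryless channel and state). -/
def codeProb (M : FSMAC S Sa Sb Xa Xb Y) {n : ℕ} {Wa Wb : Type}
    [Fintype Wa] [Fintype Wb] (C : Code M n Wa Wb) (wa : Wa) (wb : Wb)
    (s : Fin n → S) (sa : Fin n → Sa) (sb : Fin n → Sb) (y : Fin n → Y) : ℝ :=
  (Fintype.card Wa : ℝ)⁻¹ * (Fintype.card Wb : ℝ)⁻¹ *
    ∏ t : Fin n,
      (M.PS (s t) * M.Qa (s t) (sa t) * M.Qb (s t) (sb t) *
        M.chan (C.encA t (fun i => sa (Fin.castLE t.isLt i)) wa)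
          (C.encB t (fun i => sb (Fin.castLE t.isLt i)) wb) (s t) (y t))

open Classical in
/-- Probability of an event under the code-induced joint law. -/
def codePr (M : FSMAC S Sa Sb Xa Xb Y) {n : ℕ} {Wa Wb : Type}
    [Fintype Wa] [Fintype Wb] (C : Code M n Wa Wb)
    (E : Wa → Wb → (Fin n → S) → (Fin n → Sa) → (Fin n → Sb) → (Fin n → Y) → Prop) : ℝ :=
  ∑ wa, ∑ wb, ∑ s, ∑ sa, ∑ sb, ∑ y,
    if E wa wb s sa sb y then codeProb M C wa wb s sa sb y else 0

/-- Average probability of error of a code. -/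
def errProb (M : FSMAC S Sa Sb Xa Xb Y) {n : ℕ} {Wa Wb : Type}
    [Fintype Wa] [Fintype Wb] (C : Code M n Wa Wb) : ℝ :=
  codePr M C (fun wa wb s _ _ y => C.dec s y ≠ (wa, wb))

/-- A rate pair is achievable if for every `ε > 0` and all large enough `n` there is a
code of blocklength `n` with rates at least `(Ra, Rb)` and error probability `≤ ε`. -/
def Achievable (M : FSMAC S Sa Sb Xa Xb Y) (Ra Rb : ℝ) : Prop :=
  0 ≤ Ra ∧ 0 ≤ Rb ∧
    ∀ ε : ℝ, 0 < ε → ∃ N : ℕ, ∀ n : ℕ, N ≤ n →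
      ∃ (Ma Mb : ℕ) (C : Code M n (Fin Ma) (Fin Mb)),
        Ra ≤ Real.logb 2 Ma / n ∧ Rb ≤ Real.logb 2 Mb / n ∧ errProb M C ≤ ε

/-- The capacity region `C_FS`: closure of the set of achievable rate pairs. -/
def capRegion (M : FSMAC S Sa Sb Xa Xb Y) : Set (ℝ × ℝ) :=
  closure {R : ℝ × ℝ | Achievable M R.1 R.2}

/-- `sup_{π_{T^a} ⊗ π_{T^b}} I(T^a,T^b;Y|S)`. -/
def sumRateSup (M : FSMAC S Sa Sb Xa Xb Y) : ℝ :=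
  sSup {x : ℝ | ∃ (πa : (Sa → Xa) → ℝ) (πb : (Sb → Xb) → ℝ),
    isPMF πa ∧ isPMF πb ∧ x = Isum M πa πb}

/-- Binary entropy function (base 2). -/
def binEnt (x : ℝ) : ℝ := -(x * Real.logb 2 x) - (1 - x) * Real.logb 2 (1 - x)

/-- The strict prefix `x_{[t-1]}` of a length-`n` sequence (entries before time `t`). -/
def prefixOf {α : Type} {n : ℕ} (x : Fin n → α) (t : Fin n) : Fin t.1 → α :=
  fun i => x (Fin.castLE t.isLt.le i)

/-- The Shannon strategy `T_t^a = φ_t^a(W_a, S^a_{[t-1]})` induced by encoder `a`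
at time `t`: the map `s^a ↦ φ_t^a((S^a_{[t-1]}, s^a), W_a)`. -/
def stratA {S Sa Sb Xa Xb Y : Type} [Fintype S] [Fintype Sa] [Fintype Sb]
    [Fintype Xa] [Fintype Xb] [Fintype Y] {M : FSMAC S Sa Sb Xa Xb Y} {n : ℕ}
    {Wa Wb : Type} (C : Code M n Wa Wb) (t : Fin n) (wa : Wa) (sa : Fin n → Sa) :
    Sa → Xa :=
  fun x => C.encA t (Fin.snoc (prefixOf sa t) x) wa

/-- The Shannon strategy `T_t^b = φ_t^b(W_b, S^b_{[t-1]})` induced by encoder `b`. -/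
def stratB {S Sa Sb Xa Xb Y : Type} [Fintype S] [Fintype Sa] [Fintype Sb]
    [Fintype Xa] [Fintype Xb] [Fintype Y] {M : FSMAC S Sa Sb Xa Xb Y} {n : ℕ}
    {Wa Wb : Type} (C : Code M n Wa Wb) (t : Fin n) (wb : Wb) (sb : Fin n → Sb) :
    Sb → Xb :=
  fun x => C.encB t (Fin.snoc (prefixOf sb t) x) wb

variable {S Sa Sb Xa Xb Y : Type} [Fintype S] [Fintype Sa] [Fintype Sb]
  [Fintype Xa] [Fintype Xb] [Fintype Y] [DecidableEq Sa] [DecidableEq Sb]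

/-- Conditional joint law of `(T_t^a, T_t^b, Y_t, S_t)` given `S_{[t-1]} = σ`,
under the code-induced law. -/
def condLaw (M : FSMAC S Sa Sb Xa Xb Y) {n : ℕ} {Wa Wb : Type}
    [Fintype Wa] [Fintype Wb] (C : Code M n Wa Wb) (t : Fin n) (σ : Fin t.1 → S) :
    ((Sa → Xa) × (Sb → Xb)) × Y × S → ℝ :=
  fun x =>
    codePr M C (fun wa wb s sa sb y =>
        prefixOf s t = σ ∧ stratA C t wa sa = x.1.1 ∧ stratB C t wb sb = x.1.2 ∧
          y t = x.2.1 ∧ s t = x.2.2) /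
      codePr M C (fun _ _ s _ _ _ => prefixOf s t = σ)

/-- The strategy `φ_t^a(w_a, σ_a) ∈ 𝒯^a` obtained from encoder `a` by fixing the
observation prefix to `σ_a` and the message to `w_a`. -/
def encStratA {M : FSMAC S Sa Sb Xa Xb Y} {n : ℕ} {Wa Wb : Type}
    (C : Code M n Wa Wb) (t : Fin n) (σa : Fin t.1 → Sa) (wa : Wa) : Sa → Xa :=
  fun x => C.encA t (Fin.snoc σa x) wa

/-- The strategy `φ_t^b(w_b, σ_b) ∈ 𝒯^b`. -/
def encStratB {M : FSMAC S Sa Sb Xa Xb Y} {n : ℕ} {Wa Wb : Type}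
    (C : Code M n Wa Wb) (t : Fin n) (σb : Fin t.1 → Sb) (wb : Wb) : Sb → Xb :=
  fun x => C.encB t (Fin.snoc σb x) wb

open Classical in
/-- `π^σ_{T^a}(t^a) = Σ_{σ_a} P(S^a_{[t-1]} = σ_a | S_{[t-1]} = σ) ·
|{w_a : φ_t^a(w_a,σ_a) = t^a}| / |𝒲_a|`. -/
def piA (M : FSMAC S Sa Sb Xa Xb Y) {n : ℕ} {Wa Wb : Type}
    [Fintype Wa] [Fintype Wb] (C : Code M n Wa Wb) (t : Fin n) (σ : Fin t.1 → S)
    (ta : Sa → Xa) : ℝ :=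
  ∑ σa : Fin t.1 → Sa,
    (codePr M C (fun _ _ s sa _ _ => prefixOf s t = σ ∧ prefixOf sa t = σa) /
        codePr M C (fun _ _ s _ _ _ => prefixOf s t = σ)) *
      ((Finset.univ.filter fun wa : Wa => encStratA C t σa wa = ta).card /
        (Fintype.card Wa : ℝ))

open Classical in
/-- `π^σ_{T^b}(t^b)`, defined analogously. -/
def piB (M : FSMAC S Sa Sb Xa Xb Y) {n : ℕ} {Wa Wb : Type}
    [Fintype Wa] [Fintype Wb] (C : Code M n Wa Wb) (t : Fin n) (σ : Fin t.1 → S)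
    (tb : Sb → Xb) : ℝ :=
  ∑ σb : Fin t.1 → Sb,
    (codePr M C (fun _ _ s _ sb _ => prefixOf s t = σ ∧ prefixOf sb t = σb) /
        codePr M C (fun _ _ s _ _ _ => prefixOf s t = σ)) *
      ((Finset.univ.filter fun wb : Wb => encStratB C t σb wb = tb).card /
        (Fintype.card Wb : ℝ))

/-- `η(ε) = (ε/(1-ε))·log₂|𝒴| + H_b(ε)/(1-ε)`. -/
def eta (Ycard : ℕ) (ε : ℝ) : ℝ :=
  ε / (1 - ε) * Real.logb 2 Ycard + binEnt ε / (1 - ε)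

open Classical in
/-- Joint pmf of a pair of random variables defined on the code-induced sample space. -/
def rvDist2 {S Sa Sb Xa Xb Y : Type} [Fintype S] [Fintype Sa] [Fintype Sb]
    [Fintype Xa] [Fintype Xb] [Fintype Y] [DecidableEq Sa] [DecidableEq Sb]
    {α β : Type} [Fintype α] [Fintype β] (M : FSMAC S Sa Sb Xa Xb Y) {n : ℕ}
    {Wa Wb : Type} [Fintype Wa] [Fintype Wb] (C : Code M n Wa Wb)
    (f : Wa → Wb → (Fin n → S) → (Fin n → Sa) → (Fin n → Sb) → (Fin n → Y) → α)
    (g : Wa → Wb → (Fin n → S) → (Fin n → Sa) → (Fin n → Sb) → (Fin n → Y) → β) :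
    α × β → ℝ :=
  fun p => codePr M C (fun wa wb s sa sb y =>
    f wa wb s sa sb y = p.1 ∧ g wa wb s sa sb y = p.2)

open Classical in
/-- Joint pmf of a triple of random variables on the code-induced sample space. -/
def rvDist3 {S Sa Sb Xa Xb Y : Type} [Fintype S] [Fintype Sa] [Fintype Sb]
    [Fintype Xa] [Fintype Xb] [Fintype Y] [DecidableEq Sa] [DecidableEq Sb]
    {α β γ : Type} [Fintype α] [Fintype β] [Fintype γ] (M : FSMAC S Sa Sb Xa Xb Y)
    {n : ℕ} {Wa Wb : Type} [Fintype Wa] [Fintype Wb] (C : Code M n Wa Wb)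
    (f : Wa → Wb → (Fin n → S) → (Fin n → Sa) → (Fin n → Sb) → (Fin n → Y) → α)
    (g : Wa → Wb → (Fin n → S) → (Fin n → Sa) → (Fin n → Sb) → (Fin n → Y) → β)
    (h : Wa → Wb → (Fin n → S) → (Fin n → Sa) → (Fin n → Sb) → (Fin n → Y) → γ) :
    α × β × γ → ℝ :=
  fun p => codePr M C (fun wa wb s sa sb y =>
    f wa wb s sa sb y = p.1 ∧ g wa wb s sa sb y = p.2.1 ∧ h wa wb s sa sb y = p.2.2)

open Classical in
/-- Pushforward of a weight. -/
def pw {Ω α : Type} [Fintype Ω] (p : Ω → ℝ) (f : Ω → α) : α → ℝ :=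
  fun a => ∑ ω, if f ω = a then p ω else 0

/-- Entropy of a random variable. -/
def HH {Ω α : Type} [Fintype Ω] [Fintype α] (p : Ω → ℝ) (f : Ω → α) : ℝ := ent (pw p f)

theorem pw_sum {Ω α : Type} [Fintype Ω] [Fintype α] (p : Ω → ℝ) (f : Ω → α) (F : α → ℝ) :
    ∑ a, pw p f a * F a = ∑ ω, p ω * F (f ω) := by
  classical
  unfold pw
  simp_rw [Finset.sum_mul]
  rw [Finset.sum_comm]
  refine Finset.sum_congr rfl fun ω _ => ?_
  rw [Finset.sum_eq_single (f ω)]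
  · simp
  · intro b _ hb
    rw [if_neg (fun h => hb h.symm), zero_mul]
  · simp

theorem pw_total {Ω α : Type} [Fintype Ω] [Fintype α] (p : Ω → ℝ) (f : Ω → α) :
    ∑ a, pw p f a = ∑ ω, p ω := by
  simpa using pw_sum p f (fun _ => 1)

theorem pw_nonneg {Ω α : Type} [Fintype Ω] (p : Ω → ℝ) (hp : ∀ ω, 0 ≤ p ω) (f : Ω → α) (a : α) :
    0 ≤ pw p f a := by
  unfold pw
  exact Finset.sum_nonneg fun ω _ => by split_ifs <;> simp [hp]

theorem pw_pos {Ω α : Type} [Fintype Ω] (p : Ω → ℝ) (hp : ∀ ω, 0 ≤ p ω) (f : Ω → α) (ω : Ω)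
    (h : 0 < p ω) : 0 < pw p f (f ω) := by
  unfold pw
  refine Finset.sum_pos' (fun ω _ => by split_ifs <;> simp [hp]) ⟨ω, by simp, by simpa using h⟩

theorem pw_pw {Ω α β : Type} [Fintype Ω] [Fintype α] (p : Ω → ℝ) (f : Ω → α) (g : α → β) :
    pw (pw p f) g = pw p (fun ω => g (f ω)) := by
  classical
  funext b
  have := pw_sum p f (fun a => if g a = b then 1 else 0)
  simp only [mul_ite, mul_one, mul_zero] at this
  rw [pw, pw]
  convert this

theorem HH_pw {Ω α β : Type} [Fintype Ω] [Fintype α] [Fintype β] (p : Ω → ℝ) (f : Ω → α)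
    (g : α → β) : HH (pw p f) g = HH p (fun ω => g (f ω)) := by
  rw [HH, HH, pw_pw]

theorem HH_eq {Ω α : Type} [Fintype Ω] [Fintype α] (p : Ω → ℝ) (f : Ω → α) :
    HH p f = -∑ ω, p ω * Real.logb 2 (pw p f (f ω)) := by
  rw [HH, ent, pw_sum p f (fun a => Real.logb 2 (pw p f a))]

theorem pw_congr {Ω α β : Type} [Fintype Ω] (p : Ω → ℝ) (f : Ω → α) (g : Ω → β) (a : α) (b : β)
    (h : ∀ ω, f ω = a ↔ g ω = b) : pw p f a = pw p g b := by
  classical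
  unfold pw
  refine Finset.sum_congr rfl fun ω _ => ?_
  exact if_congr (h ω) rfl rfl

theorem HH_congr {Ω α β : Type} [Fintype Ω] [Fintype α] [Fintype β] (p : Ω → ℝ) (f : Ω → α)
    (g : Ω → β) (h : ∀ ω ω', f ω' = f ω ↔ g ω' = g ω) : HH p f = HH p g := by
  rw [HH_eq, HH_eq]
  congr 1
  refine Finset.sum_congr rfl fun ω _ => ?_
  congr 2
  classical
  unfold pw
  refine Finset.sum_congr rfl fun ω' _ => ?_
  exact if_congr (h ω ω') rfl rfl

theorem pw_fst {Ω α β : Type} [Fintype Ω] [Fintype α] [Fintype β] (p : Ω → ℝ) (f : Ω → α × β)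
    (a : α) : ∑ b, pw p f (a, b) = pw p (fun ω => (f ω).1) a := by
  classical
  unfold pw
  rw [Finset.sum_comm]
  refine Finset.sum_congr rfl fun ω _ => ?_
  by_cases h : (f ω).1 = a
  · rw [Finset.sum_eq_single (f ω).2]
    · simp [← h]
    · intro b _ hb
      rw [if_neg]
      intro h'
      exact hb (by rw [h'])
    · simp
  · rw [if_neg h]
    refine Finset.sum_eq_zero fun b _ => ?_
    rw [if_neg]
    intro h'
    exact h (by rw [h'])

theorem pw_snd {Ω α β : Type} [Fintype Ω] [Fintype α] [Fintype β] (p : Ω → ℝ) (f : Ω → α × β)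
    (b : β) : ∑ a, pw p f (a, b) = pw p (fun ω => (f ω).2) b := by
  classical
  have := pw_fst p (fun ω => (f ω).swap) b
  simp only [Prod.fst_swap] at this
  rw [← this]
  refine Finset.sum_congr rfl fun a _ => ?_
  refine pw_congr _ _ _ _ _ fun ω => ?_
  simp [Prod.ext_iff, and_comm]

theorem HH_submod {Ω α β γ : Type} [Fintype Ω] [Fintype α] [Fintype β] [Fintype γ] (p : Ω → ℝ)
    (hp : ∀ ω, 0 ≤ p ω) (f : Ω → α) (g : Ω → β) (z : β → γ) :
    HH p (fun ω => (f ω, g ω)) + HH p (fun ω => z (g ω)) ≤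
      HH p (fun ω => (f ω, z (g ω))) + HH p g := by
  set P1 := pw p (fun ω => (f ω, g ω)) with hP1
  set P2 := pw p (fun ω => z (g ω)) with hP2
  set P3 := pw p (fun ω => (f ω, z (g ω))) with hP3
  set P4 := pw p g with hP4
  have n1 : ∀ x, 0 ≤ P1 x := pw_nonneg p hp _
  have n2 : ∀ x, 0 ≤ P2 x := pw_nonneg p hp _
  have n3 : ∀ x, 0 ≤ P3 x := pw_nonneg p hp _
  have n4 : ∀ x, 0 ≤ P4 x := pw_nonneg p hp _
  have l2 : 0 < Real.log 2 := Real.log_pos (by norm_num)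
  have key : ∑ ω, p ω * (P3 (f ω, z (g ω)) * P4 (g ω) / (P1 (f ω, g ω) * P2 (z (g ω)))) ≤
      ∑ ω, p ω := by
    rw [← pw_sum p (fun ω => (f ω, g ω))
      (fun x => P3 (x.1, z x.2) * P4 x.2 / (P1 x * P2 (z x.2)))]
    calc _ ≤ ∑ x : α × β, P3 (x.1, z x.2) * (P4 x.2 / P2 (z x.2)) := by
          refine Finset.sum_le_sum fun x _ => ?_
          rw [← hP1]
          rcases (n1 x).eq_or_lt with h | h
          · rw [← h, zero_mul]
            exact mul_nonneg (n3 _) (div_nonneg (n4 _) (n2 _))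
          · apply le_of_eq
            rcases (n2 (z x.2)).eq_or_lt with h2 | h2
            · simp [← h2]
            · field_simp
      _ = ∑ b, P2 (z b) * (P4 b / P2 (z b)) := by
          rw [Fintype.sum_prod_type_right]
          refine Finset.sum_congr rfl fun b _ => ?_
          simp only
          rw [← Finset.sum_mul, hP3, pw_snd]
      _ ≤ ∑ b, P4 b := by
          refine Finset.sum_le_sum fun b _ => ?_
          rcases (n2 (z b)).eq_or_lt with h2 | h2
          · rw [← h2, zero_mul]
            exact n4 _
          · exact le_of_eq (by field_simp)
      _ = ∑ ω, p ω := pw_total p g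
  have main : ∑ ω, p ω * (Real.logb 2 (P3 (f ω, z (g ω))) + Real.logb 2 (P4 (g ω))
      - Real.logb 2 (P1 (f ω, g ω)) - Real.logb 2 (P2 (z (g ω)))) ≤ 0 := by
    have : ∀ ω, p ω * (Real.logb 2 (P3 (f ω, z (g ω))) + Real.logb 2 (P4 (g ω))
      - Real.logb 2 (P1 (f ω, g ω)) - Real.logb 2 (P2 (z (g ω)))) ≤
      (p ω * (P3 (f ω, z (g ω)) * P4 (g ω) / (P1 (f ω, g ω) * P2 (z (g ω)))) - p ω)
        / Real.log 2 := by
      intro ω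
      rcases (hp ω).eq_or_lt with h | h
      · simp [← h]
      have h1 : 0 < P1 (f ω, g ω) := pw_pos p hp (fun ω => (f ω, g ω)) ω h
      have h2 : 0 < P2 (z (g ω)) := pw_pos p hp (fun ω => z (g ω)) ω h
      have h3 : 0 < P3 (f ω, z (g ω)) := pw_pos p hp (fun ω => (f ω, z (g ω))) ω h
      have h4 : 0 < P4 (g ω) := pw_pos p hp g ω h
      have hx := Real.log_le_sub_one_of_pos
        (show 0 < P3 (f ω, z (g ω)) * P4 (g ω) / (P1 (f ω, g ω) * P2 (z (g ω))) by positivity)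
      rw [Real.log_div (by positivity) (by positivity), Real.log_mul h3.ne' h4.ne',
        Real.log_mul h1.ne' h2.ne'] at hx
      rw [le_div_iff₀ l2]
      unfold Real.logb
      have e : p ω * (Real.log (P3 (f ω, z (g ω))) / Real.log 2 + Real.log (P4 (g ω)) / Real.log 2
        - Real.log (P1 (f ω, g ω)) / Real.log 2 - Real.log (P2 (z (g ω))) / Real.log 2)
        * Real.log 2 = p ω * (Real.log (P3 (f ω, z (g ω))) + Real.log (P4 (g ω)) -
        (Real.log (P1 (f ω, g ω)) + Real.log (P2 (z (g ω))))) := by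
        field_simp
        ring
      rw [e]
      nlinarith [mul_le_mul_of_nonneg_left hx h.le]
    refine (Finset.sum_le_sum fun ω _ => this ω).trans ?_
    rw [← Finset.sum_div, Finset.sum_sub_distrib]
    exact div_nonpos_of_nonpos_of_nonneg (by linarith) l2.le
  rw [HH_eq, HH_eq, HH_eq, HH_eq]
  simp only [mul_sub, mul_add, Finset.sum_sub_distrib, Finset.sum_add_distrib] at main
  linarith

theorem ent_prod {α β : Type} [Fintype α] [Fintype β] (q : α → ℝ) (k : α → β → ℝ)
    (hk : ∀ a, ∑ b, k a b = 1) :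
    ent (fun x : α × β => q x.1 * k x.1 x.2) = ent q + ∑ a, q a * ent (k a) := by
  unfold ent
  rw [Fintype.sum_prod_type]
  have : ∀ a, ∑ b, q a * k a b * Real.logb 2 (q a * k a b) =
      q a * Real.logb 2 (q a) + q a * ∑ b, k a b * Real.logb 2 (k a b) := by
    intro a
    have : ∀ b, q a * k a b * Real.logb 2 (q a * k a b) =
      k a b * (q a * Real.logb 2 (q a)) + q a * (k a b * Real.logb 2 (k a b)) := by
      intro b
      by_cases h1 : q a = 0
      · simp [h1]
      by_cases h2 : k a b = 0
      · simp [h2]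
      rw [Real.logb_mul h1 h2]
      ring
    simp_rw [this]
    rw [Finset.sum_add_distrib, ← Finset.sum_mul, hk, one_mul, Finset.mul_sum]
  simp_rw [this]
  rw [Finset.sum_add_distrib]
  simp only [mul_neg, Finset.sum_neg_distrib]
  ring

/-- Entropy of `(g, y)` when `y` is produced by a kernel that only depends on `g`. -/
theorem HH_kernel {Ω α β : Type} [Fintype Ω] [Fintype α] [Fintype β] (q : Ω → ℝ)
    (g : Ω → α) (k : α → β → ℝ) (hk : ∀ a, ∑ b, k a b = 1) :
    HH (fun x : Ω × β => q x.1 * k (g x.1) x.2) (fun x => (g x.1, x.2)) =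
      HH q g + ∑ ω, q ω * ent (k (g ω)) := by
  classical
  rw [HH, HH, ← pw_sum q g (fun a => ent (k a)), ← ent_prod _ _ hk]
  congr 1
  funext ⟨a, b⟩
  simp only [pw]
  rw [Fintype.sum_prod_type, Finset.sum_mul]
  refine Finset.sum_congr rfl fun ω _ => ?_
  rw [Finset.sum_eq_single b]
  · by_cases h : g ω = a
    · simp [h]
    · simp [h]
  · intro b' _ hb
    simp [hb]
  · simp

theorem pw_kernel_fst {Ω β : Type} [Fintype Ω] [Fintype β] (q : Ω → ℝ)
    (k : Ω → β → ℝ) (hk : ∀ a, ∑ b, k a b = 1) :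
    pw (fun x : Ω × β => q x.1 * k x.1 x.2) Prod.fst = q := by
  classical
  funext a
  simp only [pw]
  rw [Fintype.sum_prod_type, Finset.sum_eq_single a]
  · simp [← Finset.mul_sum, hk]
  · intro b _ hb
    simp [hb]
  · simp

/-- Abstract one-step inequality. -/
theorem step_ineq {Ω S Y T A B D : Type} [Fintype Ω] [Fintype S] [Fintype Y] [Fintype T]
    [Fintype A] [Fintype B] [Fintype D] (μ : Ω → ℝ) (hμ : ∀ ω, 0 ≤ μ ω)
    (PS : S → ℝ) (hS : isPMF PS) (K : T → S → Y → ℝ) (hK : ∀ t s, isPMF (K t s))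
    (W : Ω → A) (V : Ω → B) (z : B → D) (τ : Ω → T)
    (q : (Ω × S) × Y → ℝ) (hq : q = fun x => μ x.1.1 * PS x.1.2 * K (τ x.1.1) x.1.2 x.2) :
    HH q (fun x => ((V x.1.1, x.1.2), x.2)) - HH q (fun x => (((W x.1.1, V x.1.1), x.1.2), x.2))
      - HH μ V + HH μ (fun ω => (W ω, V ω)) ≤
    HH q (fun x => (τ x.1.1, (z (V x.1.1), x.1.2))) + HH q (fun x => (x.2, (z (V x.1.1), x.1.2)))
      - HH q (fun x => (τ x.1.1, x.2, (z (V x.1.1), x.1.2)))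
      - HH q (fun x => (z (V x.1.1), x.1.2)) := by
  set r : Ω × S → ℝ := fun x => μ x.1 * PS x.2 with hr
  have hq0 : ∀ x, 0 ≤ q x := by
    intro x
    rw [hq]
    exact mul_nonneg (mul_nonneg (hμ _) (hS.1 _)) ((hK _ _).1 _)
  have hqr : pw q Prod.fst = r := by
    rw [hq]
    exact pw_kernel_fst r (fun x y => K (τ x.1) x.2 y) (fun x => (hK _ _).2)
  have hfst : ∀ {γ : Type} [Fintype γ] (g : Ω × S → γ), HH q (fun x => g x.1) = HH r g := by
    intro γ _ g
    rw [← hqr, HH_pw]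
  have hind : ∀ {γ : Type} [Fintype γ] (g : Ω → γ),
      HH r (fun x => (g x.1, x.2)) = HH μ g + ∑ ω, μ ω * ent PS := by
    intro γ _ g
    exact HH_kernel μ g (fun _ => PS) (fun _ => hS.2)
  -- kernel identities
  have k1 : HH q (fun x => (x.1, x.2)) = HH r (fun x => x) + ∑ x, r x * ent (K (τ x.1) x.2) := by
    rw [hq]
    exact HH_kernel r (fun x => x) (fun x => K (τ x.1) x.2) (fun x => (hK _ _).2)
  have k2 : HH q (fun x => ((τ x.1.1, (z (V x.1.1), x.1.2)), x.2)) =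
      HH r (fun x => (τ x.1, (z (V x.1), x.2))) + ∑ x, r x * ent (K (τ x.1) x.2) := by
    rw [hq]
    exact HH_kernel r (fun x => (τ x.1, (z (V x.1), x.2))) (fun x => K x.1 x.2.2)
      (fun x => (hK _ _).2)
  have k2' : HH q (fun x => ((τ x.1.1, (z (V x.1.1), x.1.2)), x.2)) =
      HH q (fun x => (τ x.1.1, x.2, (z (V x.1.1), x.1.2))) := by
    apply HH_congr
    intro ω ω'
    simp only [Prod.mk.injEq]
    tauto
  -- submodularity
  have s1 := HH_submod q hq0 (fun x => x.2) (fun x => (V x.1.1, x.1.2)) (fun b => (z b.1, b.2))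
  have s2 := HH_submod q hq0 (fun x => x.2) (fun x => x.1) (fun b => ((W b.1, V b.1), b.2))
  have c1 : HH q (fun x => (x.2, (V x.1.1, x.1.2))) = HH q (fun x => ((V x.1.1, x.1.2), x.2)) := by
    apply HH_congr
    intro ω ω'
    simp only [Prod.mk.injEq]
    tauto
  have c2 : HH q (fun x => (x.2, x.1)) = HH q (fun x => (x.1, x.2)) := by
    apply HH_congr
    intro ω ω'
    simp only [Prod.mk.injEq]
    tauto
  have c3 : HH q (fun x => (x.2, ((W x.1.1, V x.1.1), x.1.2))) =
      HH q (fun x => (((W x.1.1, V x.1.1), x.1.2), x.2)) := by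
    apply HH_congr
    intro ω ω'
    simp only [Prod.mk.injEq]
    tauto
  have f1 := hfst (fun x => (V x.1, x.2))
  have f2 := hfst (fun x => ((W x.1, V x.1), x.2))
  have f3 := hfst (fun x => x)
  have f4 := hfst (fun x => (τ x.1, (z (V x.1), x.2)))
  have i1 := hind V
  have i2 := hind (fun ω => (W ω, V ω))
  simp only at s1 s2 f1 f2 f3 f4 i1 i2
  linarith

theorem mutInfo_pw {Ω α β : Type} [Fintype Ω] [Fintype α] [Fintype β] (p : Ω → ℝ)
    (f : Ω → α) (g : Ω → β) :
    mutInfo (pw p (fun ω => (f ω, g ω))) = HH p f + HH p g - HH p (fun ω => (f ω, g ω)) := by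
  unfold mutInfo
  simp_rw [pw_fst, pw_snd]
  rfl

theorem condMutInfo_pw {Ω α β γ : Type} [Fintype Ω] [Fintype α] [Fintype β] [Fintype γ]
    (p : Ω → ℝ) (f : Ω → α) (g : Ω → β) (h : Ω → γ) :
    condMutInfo (pw p (fun ω => (f ω, g ω, h ω))) =
      HH p (fun ω => (f ω, h ω)) + HH p (fun ω => (g ω, h ω)) - HH p (fun ω => (f ω, g ω, h ω))
      - HH p h := by
  have e1 : (fun ac : α × γ => ∑ b, pw p (fun ω => (f ω, g ω, h ω)) (ac.1, b, ac.2)) =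
      pw p (fun ω => (f ω, h ω)) := by
    classical
    funext ⟨a, c⟩
    have := pw_snd p (fun ω => (g ω, (f ω, h ω))) (a, c)
    simp only at this ⊢
    rw [← this]
    refine Finset.sum_congr rfl fun b _ => ?_
    refine pw_congr _ _ _ _ _ fun ω => ?_
    simp only [Prod.mk.injEq]
    tauto
  have e2 : (fun bc : β × γ => ∑ a, pw p (fun ω => (f ω, g ω, h ω)) (a, bc.1, bc.2)) =
      pw p (fun ω => (g ω, h ω)) := by
    funext ⟨b, c⟩
    exact pw_snd p (fun ω => (f ω, g ω, h ω)) (b, c)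
  have e3 : (fun c : γ => ∑ a, ∑ b, pw p (fun ω => (f ω, g ω, h ω)) (a, b, c)) = pw p h := by
    funext c
    have h1 := congrArg (fun F : α × γ → ℝ => fun a => F (a, c)) e1
    have h2 := fun a => congrFun h1 a
    simp only at h2
    simp_rw [h2]
    exact pw_snd p (fun ω => (f ω, h ω)) c
  unfold condMutInfo
  rw [e1, e2, e3]
  rfl

/-- Sample space for blocklength `n`. -/
abbrev Om (S Sa Sb Y Wa Wb : Type) (n : ℕ) : Type :=
  Wa × Wb × (Fin n → S) × (Fin n → Sa) × (Fin n → Sb) × (Fin n → Y)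

/-- The law on the sample space induced by a pair of encoders. -/
def Pn {S Sa Sb Xa Xb Y Wa Wb : Type} [Fintype S] [Fintype Sa] [Fintype Sb]
    [Fintype Xa] [Fintype Xb] [Fintype Y] [Fintype Wa] [Fintype Wb]
    (M : FSMAC S Sa Sb Xa Xb Y) (n : ℕ)
    (eA : (t : Fin n) → (Fin (t.1 + 1) → Sa) → Wa → Xa)
    (eB : (t : Fin n) → (Fin (t.1 + 1) → Sb) → Wb → Xb)
    (ω : Om S Sa Sb Y Wa Wb n) : ℝ :=
  (Fintype.card Wa : ℝ)⁻¹ * (Fintype.card Wb : ℝ)⁻¹ *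
    ∏ t : Fin n,
      (M.PS (ω.2.2.1 t) * M.Qa (ω.2.2.1 t) (ω.2.2.2.1 t) * M.Qb (ω.2.2.1 t) (ω.2.2.2.2.1 t) *
        M.chan (eA t (fun i => ω.2.2.2.1 (Fin.castLE t.isLt i)) ω.1)
          (eB t (fun i => ω.2.2.2.2.1 (Fin.castLE t.isLt i)) ω.2.1) (ω.2.2.1 t)
            (ω.2.2.2.2.2 t))

theorem Pn_nonneg {S Sa Sb Xa Xb Y Wa Wb : Type} [Fintype S] [Fintype Sa] [Fintype Sb]
    [Fintype Xa] [Fintype Xb] [Fintype Y] [Fintype Wa] [Fintype Wb]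
    (M : FSMAC S Sa Sb Xa Xb Y) (n : ℕ)
    (eA : (t : Fin n) → (Fin (t.1 + 1) → Sa) → Wa → Xa)
    (eB : (t : Fin n) → (Fin (t.1 + 1) → Sb) → Wb → Xb)
    (ω : Om S Sa Sb Y Wa Wb n) : 0 ≤ Pn M n eA eB ω := by
  unfold Pn
  refine mul_nonneg (by positivity) (Finset.prod_nonneg fun t _ => ?_)
  exact mul_nonneg (mul_nonneg (mul_nonneg (M.PS_pmf.1 _) ((M.Qa_pmf _).1 _))
    ((M.Qb_pmf _).1 _)) ((M.chan_pmf _ _ _).1 _)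

/-- Strategies at time `t`, from encoders. -/
def tau {S Sa Sb Xa Xb Y Wa Wb : Type} {n : ℕ}
    (eA : (t : Fin n) → (Fin (t.1 + 1) → Sa) → Wa → Xa)
    (eB : (t : Fin n) → (Fin (t.1 + 1) → Sb) → Wb → Xb) (t : Fin n)
    (ω : Om S Sa Sb Y Wa Wb n) : (Sa → Xa) × (Sb → Xb) :=
  (fun x => eA t (Fin.snoc (prefixOf ω.2.2.2.1 t) x) ω.1,
    fun x => eB t (Fin.snoc (prefixOf ω.2.2.2.2.1 t) x) ω.2.1)

/-- Drop the last time step. -/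
def rest {S Sa Sb Y Wa Wb : Type} {n : ℕ} (ω : Om S Sa Sb Y Wa Wb (n + 1)) :
    Om S Sa Sb Y Wa Wb n :=
  (ω.1, ω.2.1, fun i => ω.2.2.1 i.castSucc, fun i => ω.2.2.2.1 i.castSucc,
    fun i => ω.2.2.2.2.1 i.castSucc, fun i => ω.2.2.2.2.2 i.castSucc)

/-- Append a time step. -/
def extEquiv (S Sa Sb Y Wa Wb : Type) (n : ℕ) :
    (Om S Sa Sb Y Wa Wb n × S × Sa × Sb × Y) ≃ Om S Sa Sb Y Wa Wb (n + 1) where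
  toFun x := (x.1.1, x.1.2.1, Fin.snoc (α := fun _ => S) x.1.2.2.1 x.2.1,
    Fin.snoc (α := fun _ => Sa) x.1.2.2.2.1 x.2.2.1,
    Fin.snoc (α := fun _ => Sb) x.1.2.2.2.2.1 x.2.2.2.1,
    Fin.snoc (α := fun _ => Y) x.1.2.2.2.2.2 x.2.2.2.2)
  invFun ω := (rest ω, ω.2.2.1 (Fin.last n), ω.2.2.2.1 (Fin.last n), ω.2.2.2.2.1 (Fin.last n),
    ω.2.2.2.2.2 (Fin.last n))
  left_inv x := by simp [rest]
  right_inv ω := by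
    obtain ⟨wa, wb, s, sa, sb, y⟩ := ω
    simp only [rest, Prod.mk.injEq, true_and]
    exact ⟨Fin.snoc_init_self s, Fin.snoc_init_self sa, Fin.snoc_init_self sb,
      Fin.snoc_init_self y⟩

theorem Pn_ext {S Sa Sb Xa Xb Y Wa Wb : Type} [Fintype S] [Fintype Sa] [Fintype Sb]
    [Fintype Xa] [Fintype Xb] [Fintype Y] [Fintype Wa] [Fintype Wb]
    (M : FSMAC S Sa Sb Xa Xb Y) (n : ℕ)
    (eA : (t : Fin (n + 1)) → (Fin (t.1 + 1) → Sa) → Wa → Xa)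
    (eB : (t : Fin (n + 1)) → (Fin (t.1 + 1) → Sb) → Wb → Xb)
    (ω : Om S Sa Sb Y Wa Wb n) (s : S) (sa : Sa) (sb : Sb) (y : Y) :
    Pn M (n + 1) eA eB (extEquiv S Sa Sb Y Wa Wb n (ω, s, sa, sb, y)) =
      Pn M n (fun t => eA t.castSucc) (fun t => eB t.castSucc) ω *
        (M.PS s * M.Qa s sa * M.Qb s sb *
          M.chan (eA (Fin.last n) (Fin.snoc (α := fun _ => Sa) ω.2.2.2.1 sa) ω.1)
            (eB (Fin.last n) (Fin.snoc (α := fun _ => Sb) ω.2.2.2.2.1 sb) ω.2.1) s y) := by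
  have hc : ∀ {α : Type} (f : Fin n → α) (a : α) (t : Fin n) (i : Fin (t.1 + 1)),
      (Fin.snoc (α := fun _ => α) f a : Fin (n + 1) → α)
        (Fin.castLE (t.castSucc).isLt i) = f (Fin.castLE t.isLt i) := by
    intro α f a t i
    have : (Fin.castLE (t.castSucc).isLt i : Fin (n + 1)) = (Fin.castLE t.isLt i).castSucc := rfl
    rw [this, Fin.snoc_castSucc]
  have hl : ∀ {α : Type} (f : Fin n → α) (a : α) (i : Fin (n + 1)),
      (Fin.snoc (α := fun _ => α) f a : Fin (n + 1) → α)
        (Fin.castLE (Fin.last n).isLt i) = (Fin.snoc (α := fun _ => α) f a : Fin (n + 1) → α) i :=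
    fun f a i => rfl
  unfold Pn
  rw [Fin.prod_univ_castSucc, ← mul_assoc]
  simp only [extEquiv, Equiv.coe_fn_mk, Fin.snoc_castSucc, Fin.snoc_last]
  congr 1
  · congr 1
    refine Finset.prod_congr rfl fun t _ => ?_
    have h1 := funext (hc ω.2.2.2.1 sa t)
    have h2 := funext (hc ω.2.2.2.2.1 sb t)
    exact congrArg₂ (fun u v => M.PS (ω.2.2.1 t) * M.Qa (ω.2.2.1 t) (ω.2.2.2.1 t) *
      M.Qb (ω.2.2.1 t) (ω.2.2.2.2.1 t) * M.chan (eA t.castSucc u ω.1) (eB t.castSucc v ω.2.1)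
        (ω.2.2.1 t) (ω.2.2.2.2.2 t)) h1 h2

theorem stratKernel_pmf {S Sa Sb Xa Xb Y : Type} [Fintype S] [Fintype Sa] [Fintype Sb]
    [Fintype Xa] [Fintype Xb] [Fintype Y]
    (M : FSMAC S Sa Sb Xa Xb Y) (ta : Sa → Xa) (tb : Sb → Xb) (s : S) :
    isPMF (stratKernel M ta tb s) := by
  constructor
  · intro y
    exact Finset.sum_nonneg fun sa _ => Finset.sum_nonneg fun sb _ =>
      mul_nonneg (mul_nonneg ((M.Qa_pmf _).1 _) ((M.Qb_pmf _).1 _)) ((M.chan_pmf _ _ _).1 _)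
  · unfold stratKernel
    rw [Finset.sum_comm]
    have : ∀ sa, ∑ y, ∑ sb, M.Qa s sa * M.Qb s sb * M.chan (ta sa) (tb sb) s y = M.Qa s sa := by
      intro sa
      rw [Finset.sum_comm]
      simp_rw [← Finset.mul_sum, (M.chan_pmf _ _ _).2, mul_one]
      rw [← Finset.mul_sum, (M.Qb_pmf s).2, mul_one]
    simp_rw [this]
    exact (M.Qa_pmf s).2

/-- Restrict to past, last state and last output. -/
def lastMap {S Sa Sb Y Wa Wb : Type} {n : ℕ} (ω : Om S Sa Sb Y Wa Wb (n + 1)) :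
    (Om S Sa Sb Y Wa Wb n × S) × Y :=
  ((rest ω, ω.2.2.1 (Fin.last n)), ω.2.2.2.2.2 (Fin.last n))

theorem tau_last {S Sa Sb Xa Xb Y Wa Wb : Type} {n : ℕ}
    (eA : (t : Fin (n + 1)) → (Fin (t.1 + 1) → Sa) → Wa → Xa)
    (eB : (t : Fin (n + 1)) → (Fin (t.1 + 1) → Sb) → Wb → Xb)
    (ω : Om S Sa Sb Y Wa Wb (n + 1)) :
    tau eA eB (Fin.last n) ω =
      (fun x => eA (Fin.last n) (Fin.snoc (α := fun _ => Sa) (rest ω).2.2.2.1 x) (rest ω).1,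
       fun x => eB (Fin.last n) (Fin.snoc (α := fun _ => Sb) (rest ω).2.2.2.2.1 x)
        (rest ω).2.1) := rfl

theorem pw_last {S Sa Sb Xa Xb Y Wa Wb : Type} [Fintype S] [Fintype Sa] [Fintype Sb]
    [Fintype Xa] [Fintype Xb] [Fintype Y] [Fintype Wa] [Fintype Wb]
    [DecidableEq Sa] [DecidableEq Sb]
    (M : FSMAC S Sa Sb Xa Xb Y) (n : ℕ)
    (eA : (t : Fin (n + 1)) → (Fin (t.1 + 1) → Sa) → Wa → Xa)
    (eB : (t : Fin (n + 1)) → (Fin (t.1 + 1) → Sb) → Wb → Xb) :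
    pw (Pn M (n + 1) eA eB) (lastMap (S := S) (Y := Y)) = fun x =>
      Pn M n (fun t => eA t.castSucc) (fun t => eB t.castSucc) x.1.1 * M.PS x.1.2 *
        stratKernel M
          (fun u => eA (Fin.last n) (Fin.snoc (α := fun _ => Sa) x.1.1.2.2.2.1 u) x.1.1.1)
          (fun u => eB (Fin.last n) (Fin.snoc (α := fun _ => Sb) x.1.1.2.2.2.2.1 u) x.1.1.2.1)
          x.1.2 x.2 := by
  classical
  funext ⟨⟨ω, s⟩, y⟩
  have hL : ∀ x, lastMap (extEquiv S Sa Sb Y Wa Wb n x) = ((x.1, x.2.1), x.2.2.2.2) := by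
    intro x
    have := (extEquiv S Sa Sb Y Wa Wb n).symm_apply_apply x
    have h1 := congrArg (fun u => ((u.1, u.2.1), u.2.2.2.2)) this
    exact h1
  unfold pw
  rw [← (extEquiv S Sa Sb Y Wa Wb n).sum_comp]
  rw [Fintype.sum_prod_type, Finset.sum_eq_single ω]
  rotate_left
  · intro ω' _ h
    refine Finset.sum_eq_zero fun x _ => ?_
    rw [hL, if_neg]
    simp [h]
  · simp
  rw [Fintype.sum_prod_type, Finset.sum_eq_single s]
  rotate_left
  · intro ω' _ h
    refine Finset.sum_eq_zero fun x _ => ?_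
    rw [hL, if_neg]
    simp [h]
  · simp
  unfold stratKernel
  rw [Finset.mul_sum, Fintype.sum_prod_type]
  refine Finset.sum_congr rfl fun sa _ => ?_
  rw [Finset.mul_sum, Fintype.sum_prod_type]
  refine Finset.sum_congr rfl fun sb _ => ?_
  rw [Finset.sum_eq_single y]
  · rw [hL, if_pos rfl, Pn_ext]
    ring
  · intro y' _ h
    rw [hL, if_neg]
    simp [h]
  · simp

theorem pw_rest {S Sa Sb Xa Xb Y Wa Wb : Type} [Fintype S] [Fintype Sa] [Fintype Sb]
    [Fintype Xa] [Fintype Xb] [Fintype Y] [Fintype Wa] [Fintype Wb]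
    [DecidableEq Sa] [DecidableEq Sb]
    (M : FSMAC S Sa Sb Xa Xb Y) (n : ℕ)
    (eA : (t : Fin (n + 1)) → (Fin (t.1 + 1) → Sa) → Wa → Xa)
    (eB : (t : Fin (n + 1)) → (Fin (t.1 + 1) → Sb) → Wb → Xb) :
    pw (Pn M (n + 1) eA eB) (rest (S := S) (Y := Y)) =
      Pn M n (fun t => eA t.castSucc) (fun t => eB t.castSucc) := by
  have h1 : pw (pw (pw (Pn M (n + 1) eA eB) (lastMap (S := S) (Y := Y))) Prod.fst) Prod.fst =
      pw (Pn M (n + 1) eA eB) (rest (S := S) (Y := Y)) := by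
    rw [pw_pw, pw_pw]
    rfl
  rw [← h1, pw_last]
  have h2 := pw_kernel_fst
    (fun x : Om S Sa Sb Y Wa Wb n × S =>
      Pn M n (fun t => eA t.castSucc) (fun t => eB t.castSucc) x.1 * M.PS x.2)
    (fun x => stratKernel M
          (fun u => eA (Fin.last n) (Fin.snoc (α := fun _ => Sa) x.1.2.2.2.1 u) x.1.1)
          (fun u => eB (Fin.last n) (Fin.snoc (α := fun _ => Sb) x.1.2.2.2.2.1 u) x.1.2.1) x.2)
    (fun x => (stratKernel_pmf M _ _ _).2)
  rw [h2]
  exact pw_kernel_fst _ (fun _ => M.PS) (fun _ => M.PS_pmf.2)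

/-- State prefix including time `t`. -/
def spre {S Sa Sb Y Wa Wb : Type} {n : ℕ} (t : Fin n) (ω : Om S Sa Sb Y Wa Wb n) :
    Fin (t.1 + 1) → S := fun i => ω.2.2.1 (Fin.castLE t.isLt i)

/-- Summand on the right-hand side. -/
def rhsT {S Sa Sb Xa Xb Y Wa Wb : Type} [Fintype S] [Fintype Sa] [Fintype Sb]
    [Fintype Xa] [Fintype Xb] [Fintype Y] [Fintype Wa] [Fintype Wb]
    [DecidableEq Sa] [DecidableEq Sb]
    (M : FSMAC S Sa Sb Xa Xb Y) (n : ℕ)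
    (eA : (t : Fin n) → (Fin (t.1 + 1) → Sa) → Wa → Xa)
    (eB : (t : Fin n) → (Fin (t.1 + 1) → Sb) → Wb → Xb) (t : Fin n) : ℝ :=
  HH (Pn M n eA eB) (fun ω => (tau eA eB t ω, spre t ω))
    + HH (Pn M n eA eB) (fun ω => (ω.2.2.2.2.2 t, spre t ω))
    - HH (Pn M n eA eB) (fun ω => (tau eA eB t ω, ω.2.2.2.2.2 t, spre t ω))
    - HH (Pn M n eA eB) (spre t)

theorem spre_last {S Sa Sb Y Wa Wb : Type} {n : ℕ} (ω ω' : Om S Sa Sb Y Wa Wb (n + 1)) :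
    spre (Fin.last n) ω = spre (Fin.last n) ω' ↔
      ω.2.2.1 = ω'.2.2.1 := Iff.rfl

theorem seq_last {α : Type} {n : ℕ} (s s' : Fin (n + 1) → α) :
    s = s' ↔ (fun i : Fin n => s i.castSucc) = (fun i : Fin n => s' i.castSucc) ∧
      s (Fin.last n) = s' (Fin.last n) := by
  constructor
  · rintro rfl
    simp
  · rintro ⟨h1, h2⟩
    funext i
    refine Fin.lastCases h2 (fun j => congrFun h1 j) i

theorem main_ind {S Sa Sb Xa Xb Y Wa Wb : Type} [Fintype S] [Fintype Sa] [Fintype Sb]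
    [Fintype Xa] [Fintype Xb] [Fintype Y] [Fintype Wa] [Fintype Wb]
    [DecidableEq Sa] [DecidableEq Sb]
    (M : FSMAC S Sa Sb Xa Xb Y) (n : ℕ) :
    ∀ (eA : (t : Fin n) → (Fin (t.1 + 1) → Sa) → Wa → Xa)
    (eB : (t : Fin n) → (Fin (t.1 + 1) → Sb) → Wb → Xb),
    HH (Pn M n eA eB) (fun ω => (ω.1, ω.2.1))
      + HH (Pn M n eA eB) (fun ω => (ω.2.2.2.2.2, ω.2.2.1))
      - HH (Pn M n eA eB) (fun ω => ((ω.1, ω.2.1), (ω.2.2.2.2.2, ω.2.2.1)))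
      ≤ ∑ t, rhsT M n eA eB t := by
  induction n with
  | zero =>
    intro eA eB
    have h1 : HH (Pn M 0 eA eB) (fun ω => (ω.1, ω.2.1)) =
        HH (Pn M 0 eA eB) (fun ω => ((ω.1, ω.2.1), (ω.2.2.2.2.2, ω.2.2.1))) := by
      apply HH_congr
      intro ω ω'
      simp only [Prod.mk.injEq]
      have := Subsingleton.elim ω'.2.2.2.2.2 ω.2.2.2.2.2
      have := Subsingleton.elim ω'.2.2.1 ω.2.2.1
      tauto
    have h2 : HH (Pn M 0 eA eB) (fun ω => (ω.2.2.2.2.2, ω.2.2.1)) = 0 := by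
      have hc : Real.logb 2 (∑ ω, Pn M 0 eA eB ω) = 0 := by
        unfold Pn
        simp only [Finset.univ_eq_empty, Finset.prod_empty, mul_one, Finset.sum_const,
          Finset.card_univ, Fintype.card_prod, Fintype.card_pi, nsmul_eq_mul]
        by_cases ha : (Fintype.card Wa : ℝ) = 0
        · simp [ha]
        by_cases hb : (Fintype.card Wb : ℝ) = 0
        · simp [hb]
        have : (Fintype.card Wa : ℝ) * (Fintype.card Wb : ℝ) *
          ((Fintype.card Wa : ℝ)⁻¹ * (Fintype.card Wb : ℝ)⁻¹) = 1 := by field_simp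
        simp [this]
      rw [HH_eq, neg_eq_zero]
      refine Finset.sum_eq_zero fun ω _ => ?_
      have : pw (Pn M 0 eA eB) (fun ω => (ω.2.2.2.2.2, ω.2.2.1)) (ω.2.2.2.2.2, ω.2.2.1) =
          ∑ ω, Pn M 0 eA eB ω := by
        unfold pw
        refine Finset.sum_congr rfl fun ω' _ => if_pos (Subsingleton.elim _ _)
      rw [this, hc, mul_zero]
    rw [h1, h2]
    simp
  | succ n ih =>
    intro eA eB
    rw [Fin.sum_univ_castSucc]
    have hpast : ∀ t : Fin n, rhsT M (n + 1) eA eB t.castSucc =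
        rhsT M n (fun t => eA t.castSucc) (fun t => eB t.castSucc) t := by
      intro t
      unfold rhsT
      rw [← pw_rest M n eA eB, HH_pw, HH_pw, HH_pw, HH_pw]
      rfl
    simp_rw [hpast]
    have ih' := ih (fun t => eA t.castSucc) (fun t => eB t.castSucc)
    have hst := step_ineq (Pn M n (fun t => eA t.castSucc) (fun t => eB t.castSucc))
      (Pn_nonneg M n _ _) M.PS M.PS_pmf
      (fun T : (Sa → Xa) × (Sb → Xb) => stratKernel M T.1 T.2)
      (fun T => stratKernel_pmf M T.1 T.2)
      (fun ω : Om S Sa Sb Y Wa Wb n => (ω.1, ω.2.1))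
      (fun ω => (ω.2.2.2.2.2, ω.2.2.1)) Prod.snd
      (fun ω => (fun x => eA (Fin.last n) (Fin.snoc (α := fun _ => Sa) ω.2.2.2.1 x) ω.1,
       fun x => eB (Fin.last n) (Fin.snoc (α := fun _ => Sb) ω.2.2.2.2.1 x) ω.2.1))
      _ (pw_last M n eA eB)
    simp only [HH_pw] at hst
    have hW : HH (Pn M (n + 1) eA eB) (fun ω : Om S Sa Sb Y Wa Wb (n + 1) => (ω.1, ω.2.1)) =
        HH (Pn M n (fun t => eA t.castSucc) (fun t => eB t.castSucc))
          (fun ω : Om S Sa Sb Y Wa Wb n => (ω.1, ω.2.1)) := by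
      rw [← pw_rest M n eA eB, HH_pw]
      rfl
    rw [hW]
    have hlast : rhsT M (n + 1) eA eB (Fin.last n) =
        HH (Pn M (n + 1) eA eB) (fun ω => (tau eA eB (Fin.last n) ω,
          ((lastMap ω).1.1.2.2.1, (lastMap ω).1.2)))
        + HH (Pn M (n + 1) eA eB) (fun ω => ((lastMap ω).2,
          ((lastMap ω).1.1.2.2.1, (lastMap ω).1.2)))
        - HH (Pn M (n + 1) eA eB) (fun ω => (tau eA eB (Fin.last n) ω, (lastMap ω).2,
          ((lastMap ω).1.1.2.2.1, (lastMap ω).1.2)))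
        - HH (Pn M (n + 1) eA eB) (fun ω => ((lastMap ω).1.1.2.2.1, (lastMap ω).1.2)) := by
      unfold rhsT
      rw [HH_congr (Pn M (n + 1) eA eB) (fun ω => (tau eA eB (Fin.last n) ω, spre (Fin.last n) ω))
        (fun ω => (tau eA eB (Fin.last n) ω, ((lastMap ω).1.1.2.2.1, (lastMap ω).1.2)))
        (by
          intro ω ω'
          simp only [Prod.mk.injEq, spre_last, seq_last ω'.2.2.1 ω.2.2.1]
          rfl),
        HH_congr (Pn M (n + 1) eA eB)
        (fun ω => (ω.2.2.2.2.2 (Fin.last n), spre (Fin.last n) ω))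
        (fun ω => ((lastMap ω).2, ((lastMap ω).1.1.2.2.1, (lastMap ω).1.2)))
        (by
          intro ω ω'
          simp only [Prod.mk.injEq, spre_last, seq_last ω'.2.2.1 ω.2.2.1]
          rfl),
        HH_congr (Pn M (n + 1) eA eB)
        (fun ω => (tau eA eB (Fin.last n) ω, ω.2.2.2.2.2 (Fin.last n), spre (Fin.last n) ω))
        (fun ω => (tau eA eB (Fin.last n) ω, (lastMap ω).2,
          ((lastMap ω).1.1.2.2.1, (lastMap ω).1.2)))
        (by
          intro ω ω'
          simp only [Prod.mk.injEq, spre_last, seq_last ω'.2.2.1 ω.2.2.1]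
          rfl),
        HH_congr (Pn M (n + 1) eA eB) (spre (Fin.last n))
        (fun ω => ((lastMap ω).1.1.2.2.1, (lastMap ω).1.2))
        (by
          intro ω ω'
          simp only [Prod.mk.injEq, spre_last, seq_last ω'.2.2.1 ω.2.2.1]
          rfl)]
    have hA : HH (Pn M (n + 1) eA eB) (fun ω => (ω.2.2.2.2.2, ω.2.2.1)) =
        HH (Pn M (n + 1) eA eB) (fun ω =>
          ((((lastMap ω).1.1.2.2.2.2.2, (lastMap ω).1.1.2.2.1), (lastMap ω).1.2),
            (lastMap ω).2)) := by
      apply HH_congr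
      intro ω ω'
      simp only [Prod.mk.injEq, seq_last ω'.2.2.1 ω.2.2.1, seq_last ω'.2.2.2.2.2 ω.2.2.2.2.2]
      simp only [lastMap, rest]
      tauto
    have hB : HH (Pn M (n + 1) eA eB) (fun ω => ((ω.1, ω.2.1), (ω.2.2.2.2.2, ω.2.2.1))) =
        HH (Pn M (n + 1) eA eB) (fun ω =>
          (((((lastMap ω).1.1.1, (lastMap ω).1.1.2.1), ((lastMap ω).1.1.2.2.2.2.2,
            (lastMap ω).1.1.2.2.1)), (lastMap ω).1.2), (lastMap ω).2)) := by
      apply HH_congr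
      intro ω ω'
      simp only [Prod.mk.injEq, seq_last ω'.2.2.1 ω.2.2.1, seq_last ω'.2.2.2.2.2 ω.2.2.2.2.2]
      simp only [lastMap, rest]
      tauto
    rw [hA, hB, hlast]
    have hst' := hst
    change _ ≤ HH (Pn M (n + 1) eA eB) (fun ω => (tau eA eB (Fin.last n) ω,
        ((lastMap ω).1.1.2.2.1, (lastMap ω).1.2))) + _
      - HH (Pn M (n + 1) eA eB) (fun ω => (tau eA eB (Fin.last n) ω, (lastMap ω).2,
          ((lastMap ω).1.1.2.2.1, (lastMap ω).1.2))) - _ at hst'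
    linarith

theorem codePr_pw {S Sa Sb Xa Xb Y : Type} [Fintype S] [Fintype Sa]
    [Fintype Sb] [Fintype Xa] [Fintype Xb] [Fintype Y] [DecidableEq Sa] [DecidableEq Sb]
    (M : FSMAC S Sa Sb Xa Xb Y) {n : ℕ} {Wa Wb : Type} [Fintype Wa] [Fintype Wb]
    (C : Code M n Wa Wb) {α : Type}
    (E : Wa → Wb → (Fin n → S) → (Fin n → Sa) → (Fin n → Sb) → (Fin n → Y) → Prop)
    (f : Om S Sa Sb Y Wa Wb n → α) (a : α)
    (h : ∀ wa wb s sa sb y, E wa wb s sa sb y ↔ f (wa, wb, s, sa, sb, y) = a) :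
    codePr M C E = pw (Pn M n C.encA C.encB) f a := by
  classical
  unfold codePr pw
  simp only [Fintype.sum_prod_type]
  refine Finset.sum_congr rfl fun wa _ => Finset.sum_congr rfl fun wb _ =>
    Finset.sum_congr rfl fun s _ => Finset.sum_congr rfl fun sa _ =>
    Finset.sum_congr rfl fun sb _ => Finset.sum_congr rfl fun y _ => ?_
  exact if_congr (h wa wb s sa sb y) rfl rfl

/-- For any blocklength-`n` code, `I(W; Y_{[n]}, S_{[n]}) ≤ Σ_{t=1}^n
I(T_t^a, T_t^b; Y_t | S_{[t]})`, where `W = (W_a, W_b)` and `T_t^a, T_t^b` are the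
Shannon strategies induced by the encoders. -/
theorem mutInfo_le_sum_singleLetter {S Sa Sb Xa Xb Y : Type} [Fintype S] [Fintype Sa]
    [Fintype Sb] [Fintype Xa] [Fintype Xb] [Fintype Y] [DecidableEq Sa] [DecidableEq Sb]
    (M : FSMAC S Sa Sb Xa Xb Y) {n : ℕ} {Wa Wb : Type} [Fintype Wa] [Fintype Wb]
    (C : Code M n Wa Wb) :
    mutInfo (rvDist2 M C (fun wa wb _ _ _ _ => (wa, wb)) (fun _ _ s _ _ y => (y, s))) ≤
      ∑ t : Fin n,
        condMutInfo (rvDist3 M C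
          (fun wa wb _ sa sb _ => (stratA C t wa sa, stratB C t wb sb))
          (fun _ _ _ _ _ y => y t)
          (fun _ _ s _ _ _ => fun i : Fin (t.1 + 1) => s (Fin.castLE t.isLt i))) := by
  have h1 : rvDist2 M C (fun wa wb _ _ _ _ => (wa, wb)) (fun _ _ s _ _ y => (y, s)) =
      pw (Pn M n C.encA C.encB) (fun ω => ((ω.1, ω.2.1), (ω.2.2.2.2.2, ω.2.2.1))) := by
    funext p
    refine codePr_pw M C _ _ p fun wa wb s sa sb y => ?_
    exact (Prod.ext_iff (x := ((wa, wb), (y, s))) (y := p)).symm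
  have h2 : ∀ t : Fin n, rvDist3 M C
          (fun wa wb _ sa sb _ => (stratA C t wa sa, stratB C t wb sb))
          (fun _ _ _ _ _ y => y t)
          (fun _ _ s _ _ _ => fun i : Fin (t.1 + 1) => s (Fin.castLE t.isLt i)) =
      pw (Pn M n C.encA C.encB)
        (fun ω => (tau C.encA C.encB t ω, ω.2.2.2.2.2 t, spre t ω)) := by
    intro t
    funext p
    refine codePr_pw M C _ _ p fun wa wb s sa sb y => ?_
    exact (and_congr_right fun _ => (Prod.ext_iff (x := (_, _)) (y := p.2)).symm).trans
      (Prod.ext_iff (x := (_, _)) (y := p)).symm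
  rw [h1, mutInfo_pw]
  simp_rw [h2, condMutInfo_pw]
  exact main_ind M n C.encA C.encB
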